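/- arXiv:1809.02155 — 3 statements merged into one kernel-verified Lean document; each statement's English description precedes it below -/
import Mathlib

section
/- Let q be a prime power, p = char(F_q), and write n = d·p^m where p does not divide d. Then the number N_n(q) of normal elements of the field extension F_{q^n}/F_q equals q^n · ∏_{e ∣ d} (1 − 1/q^{o_e(q)})^{φ(e)/o_e(q)}, where the product runs over all positive divisors e of d. -/
/-- `α` is a normal element of `L/K` if its orbit under `Gal(L/K)` is a basis of `L`
as a `K`-vector space. -/
def IsNormalElement (K : Type*) {L : Type*} [Field K] [Field L] [Algebra K L] (α : L) : Prop :=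
  LinearIndependent K (fun g : L ≃ₐ[K] L => g α) ∧
    Submodule.span K (Set.range fun g : L ≃ₐ[K] L => g α) = ⊤

open Polynomial in
theorem AdjoinRoot.isUnit_mk_iff_isCoprime {K : Type*} [CommRing K] {f h : K[X]} :
    IsUnit (AdjoinRoot.mk f h) ↔ IsCoprime h f := by
  rw [isUnit_iff_exists_inv]
  constructor
  · rintro ⟨b, hb⟩
    obtain ⟨b, rfl⟩ := AdjoinRoot.mk_surjective b
    rw [← map_mul, ← map_one (AdjoinRoot.mk f), AdjoinRoot.mk_eq_mk] at hb
    obtain ⟨c, hc⟩ := hb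
    exact ⟨b, -c, by linear_combination hc⟩
  · rintro ⟨a, b, hab⟩
    refine ⟨AdjoinRoot.mk f a, ?_⟩
    rw [← map_mul, ← map_one (AdjoinRoot.mk f), AdjoinRoot.mk_eq_mk]
    exact ⟨-b, by linear_combination hab⟩

/-- All fibres of a surjective homomorphism have the cardinality of its kernel. -/
theorem AddMonoidHom.natCard_subtype_comp {A B : Type*} [AddGroup A] [AddGroup B] (f : A →+ B)
    (hf : Function.Surjective f) (P : B → Prop) :
    Nat.card {a // P (f a)} = Nat.card {b // P b} * Nat.card f.ker := by
  obtain ⟨g, hg⟩ := hf.hasRightInverse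
  rw [← Nat.card_prod]
  exact Nat.card_congr
    { toFun := fun a ↦ (⟨f a, a.2⟩, ⟨-g (f a) + a, by simp [AddMonoidHom.mem_ker, hg (f a)]⟩)
      invFun := fun x ↦ ⟨g x.1 + x.2, by
        rw [map_add, hg, AddMonoidHom.mem_ker.mp x.2.2, add_zero]; exact x.1.2⟩
      left_inv := fun a ↦ by simp
      right_inv := fun x ↦ by
        have h : f (g x.1 + x.2) = x.1 := by
          rw [map_add, hg, AddMonoidHom.mem_ker.mp x.2.2, add_zero]
        ext <;> simp [h] }

open Polynomial in
theorem AdjoinRoot.natCard_eq_pow_natDegree {K : Type*} [Field K] [Finite K] {f : K[X]}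
    (hf : f ≠ 0) : Nat.card (AdjoinRoot f) = Nat.card K ^ f.natDegree := by
  have := (AdjoinRoot.powerBasis hf).finite
  rw [Module.natCard_eq_pow_finrank (K := K), (AdjoinRoot.powerBasis hf).finrank,
    AdjoinRoot.powerBasis_dim]

theorem natCard_isUnit_field {k : Type*} [Field k] [Finite k] :
    (Nat.card {x : k // IsUnit x} : ℚ) = Nat.card k * (1 - 1 / Nat.card k) := by
  have h : Nat.card {x : k // IsUnit x} = Nat.card kˣ :=
    Nat.card_congr ((Equiv.subtypeEquivRight fun _ ↦ isUnit_iff_ne_zero).trans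
      (unitsEquivNeZero (G₀ := k)).symm)
  have h0 : (Nat.card k : ℚ) ≠ 0 := Nat.cast_ne_zero.mpr Nat.card_pos.ne'
  rw [h, Nat.card_units, Nat.cast_sub Nat.card_pos]
  field_simp
  simp

open Polynomial in
/-- The number of units of `K[X] / f`, in terms of a set `F` of representatives of the irreducible
factors of `f`. -/
theorem AdjoinRoot.natCard_isUnit {K : Type*} [Field K] [Finite K] {f : K[X]} (hf : f ≠ 0)
    (F : Finset K[X]) (hirr : ∀ P ∈ F, Irreducible P)
    (hF : (F : Set K[X]).Pairwise IsCoprime)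
    (hfF : ∀ h, IsCoprime h f ↔ ∀ P ∈ F, IsCoprime h P) :
    (Nat.card {x : AdjoinRoot f // IsUnit x} : ℚ) =
      (Nat.card K : ℚ) ^ f.natDegree * ∏ P ∈ F, (1 - 1 / (Nat.card K : ℚ) ^ P.natDegree) := by
  have hdvd : ∀ P ∈ F, P ∣ f := fun P hP ↦ by
    by_contra h
    have := (hfF P).mp ((hirr P hP).coprime_iff_not_dvd.mpr h) P hP
    exact (hirr P hP).not_isUnit (isCoprime_self.mp this)
  have (P : F) : Fact (Irreducible P.1) := ⟨hirr P.1 P.2⟩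
  have (P : F) : Finite (AdjoinRoot P.1) := by
    have := (AdjoinRoot.powerBasis (hirr P.1 P.2).ne_zero).finite
    exact Module.finite_of_finite K
  have : Finite (AdjoinRoot f) := by
    have := (AdjoinRoot.powerBasis hf).finite
    exact Module.finite_of_finite K
  let φ : AdjoinRoot f →+* ∀ P : F, AdjoinRoot P.1 :=
    RingHom.pi fun P ↦ Ideal.Quotient.factor
      (Ideal.span_singleton_le_span_singleton.mpr (hdvd P.1 P.2))
  have hφ (h : K[X]) (P : F) : φ (AdjoinRoot.mk f h) P = AdjoinRoot.mk P.1 h := rfl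
  have hsurj : Function.Surjective φ := fun x ↦ by
    obtain ⟨h, hh⟩ := Ideal.pi_quotient_surjective (I := fun P : F ↦ Ideal.span {P.1})
      (fun P Q hPQ ↦ Ideal.isCoprime_span_singleton_iff P.1 Q.1 |>.mpr
        (hF P.2 Q.2 (Subtype.coe_injective.ne hPQ))) x
    exact ⟨AdjoinRoot.mk f h, funext hh⟩
  have hunit (x : AdjoinRoot f) : IsUnit x ↔ IsUnit (φ x) := by
    obtain ⟨h, rfl⟩ := AdjoinRoot.mk_surjective x
    simp_rw [Pi.isUnit_iff, hφ, AdjoinRoot.isUnit_mk_iff_isCoprime, hfF, Subtype.forall]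
  have h1 := φ.toAddMonoidHom.natCard_subtype_comp hsurj IsUnit
  have h2 := φ.toAddMonoidHom.natCard_subtype_comp hsurj fun _ ↦ True
  have h3 : Nat.card {x : ∀ P : F, AdjoinRoot P.1 // IsUnit x} =
      ∏ P : F, Nat.card {x : AdjoinRoot P.1 // IsUnit x} := by
    rw [← Nat.card_pi]
    exact Nat.card_congr ((Equiv.subtypeEquivRight fun x ↦ Pi.isUnit_iff).trans
      (Equiv.subtypePiEquivPi (p := fun _ x ↦ IsUnit x)))
  rw [Nat.card_congr (Equiv.subtypeUnivEquiv fun _ ↦ trivial),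
    Nat.card_congr (Equiv.subtypeUnivEquiv fun _ ↦ trivial), Nat.card_pi,
    AdjoinRoot.natCard_eq_pow_natDegree hf] at h2
  have h4 : Nat.card {x : AdjoinRoot f // IsUnit x} =
      Nat.card {x // IsUnit (φ.toAddMonoidHom x)} :=
    Nat.card_congr (Equiv.subtypeEquivRight hunit)
  have h5 := congrArg (Nat.cast : ℕ → ℚ) h2
  push_cast at h5
  rw [h4, h1, h3, h5, ← Finset.prod_coe_sort F]
  push_cast
  simp_rw [natCard_isUnit_field, Finset.prod_mul_distrib]
  have (P : F) : Nat.card (AdjoinRoot P.1) = Nat.card K ^ P.1.natDegree :=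
    AdjoinRoot.natCard_eq_pow_natDegree (hirr P.1 P.2).ne_zero
  simp_rw [this]
  push_cast
  ring

open Polynomial FiniteField Module in
/-- Normal elements of an extension `L / K` of finite fields of degree `n` correspond to units of
`K[X] / (X ^ n - 1)`. -/
theorem natCard_isNormalElement (K L : Type*) [Field K] [Field L] [Finite K] [Finite L]
    [Algebra K L] :
    Nat.card {α : L // IsNormalElement K α} =
      Nat.card {x : AdjoinRoot (X ^ finrank K L - 1 : K[X]) // IsUnit x} := by
  have := Fintype.ofFinite K
  set n := finrank K L with hn
  set f : K[X] := X ^ n - 1 with hf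
  have hmonic : f.Monic := leadingCoeff_X_pow_sub_one finrank_pos
  have hdeg : f.natDegree = n := natDegree_X_pow_sub_C (R := K) (r := 1)
  let pB := AdjoinRoot.powerBasis' hmonic
  let σ : L →ₗ[K] L := (frobeniusAlgHom K L).toLinearMap
  let ρ : AdjoinRoot f →ₐ[K] End K L := Ideal.Quotient.liftₐ (Ideal.span {f}) (aeval σ) fun g hg ↦ by
    obtain ⟨c, rfl⟩ := Ideal.mem_span_singleton.mp hg
    rw [map_mul, hf, ← minpoly_frobeniusAlgHom, minpoly.aeval, zero_mul]
  let ev (α : L) : AdjoinRoot f →ₗ[K] L := LinearMap.applyₗ α ∘ₗ ρ.toLinearMap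
  have ev_apply (α : L) (x) : ev α x = ρ x α := rfl
  let e : Fin pB.dim ≃ Gal(L/K) := (finCongr hdeg).trans
    (.ofBijective _ (bijective_frobeniusAlgEquivOfAlgebraic_pow K L))
  have hfin : finrank K (AdjoinRoot f) = finrank K L := by
    rw [pB.finrank]; exact hdeg
  have : Module.Finite K (AdjoinRoot f) := pB.finite
  have : Finite (AdjoinRoot f) := Module.finite_of_finite K
  have hev (α : L) : (fun g : Gal(L/K) ↦ g α) ∘ e = ev α ∘ pB.basis := by
    ext i
    simp only [Function.comp_apply, PowerBasis.coe_basis, ev_apply, map_pow]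
    have h1 : ρ pB.gen = σ := aeval_X σ
    have h2 : e i = frobeniusAlgEquivOfAlgebraic K L ^ i.1 := rfl
    rw [h1, h2, AlgEquiv.coe_pow, Module.End.coe_pow]
    rfl
  have hnormal (α : L) : IsNormalElement K α ↔ Function.Bijective (ev α) := by
    have hrange : Set.range (fun g : Gal(L/K) ↦ g α) = ev α '' Set.range pB.basis := by
      rw [← Set.range_comp, ← hev, e.surjective.range_comp]
    have hspan : Submodule.span K (Set.range fun g : Gal(L/K) ↦ g α) = LinearMap.range (ev α) := by
      rw [hrange, Submodule.span_image, pB.basis.span_eq, Submodule.map_top]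
    rw [IsNormalElement, hspan, LinearMap.range_eq_top, ← linearIndependent_equiv e, hev]
    refine ⟨fun h ↦ ⟨?_, h.2⟩, fun h ↦ ⟨?_, h.2⟩⟩
    · exact (LinearMap.injective_iff_surjective_of_finrank_eq_finrank hfin).mpr h.2
    · exact pB.basis.linearIndependent.map' _ (LinearMap.ker_eq_bot.mpr h.1)
  obtain ⟨α, hα⟩ := exists_linearIndependent_algEquiv_apply K L
  have hb : Function.Bijective (ev α) := by
    refine (hnormal α).mp ⟨hα, hα.span_eq_top_of_card_eq_finrank' ?_⟩
    rw [← Fintype.card_congr e, Fintype.card_fin]; exact hdeg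
  refine (Nat.card_congr ((Equiv.ofBijective _ hb).subtypeEquiv fun x ↦ ?_)).symm
  have hcomp : ⇑(ev (ev α x)) = ev α ∘ fun y ↦ y * x := by
    ext y
    simp [ev_apply]
  rw [Equiv.ofBijective_apply, hnormal, hcomp, hb.of_comp_iff', IsUnit.isUnit_iff_mulRight_bijective]

open Polynomial UniqueFactorizationMonoid in
theorem isCoprime_iff_forall_mem_normalizedFactors {K : Type*} [Field K] [DecidableEq K]
    {f h : K[X]} (hf : f ≠ 0) :
    IsCoprime h f ↔ ∀ P ∈ (normalizedFactors f).toFinset, IsCoprime h P := by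
  simp_rw [Multiset.mem_toFinset]
  refine ⟨fun hc P hP ↦ hc.of_isCoprime_of_dvd_right (dvd_of_mem_normalizedFactors hP),
    fun H ↦ ?_⟩
  refine IsCoprime.of_isCoprime_of_dvd_right ?_ (prod_normalizedFactors hf).symm.dvd
  exact Multiset.prod_induction (IsCoprime h) _ (fun _ _ ↦ IsCoprime.mul_right) isCoprime_one_right H

open Polynomial UniqueFactorizationMonoid in
/-- If `q` is a prime power, `p = char 𝔽_q` and `n = d * p ^ m` with `p ∤ d`, then the number
of normal elements of `𝔽_{q^n} / 𝔽_q` is `q ^ n * ∏_{e ∣ d} (1 - 1 / q ^ o_e(q)) ^ (φ e / o_e(q))`,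
where `o_e(q)` is the multiplicative order of `q` modulo `e`. -/
theorem card_normal_elements (q p n d m : ℕ) (hq : ∃ p' k : ℕ, p'.Prime ∧ 0 < k ∧ q = p' ^ k)
    (Fq Fqn : Type*) [Field Fq] [Field Fqn] [Fintype Fq] [Fintype Fqn] [Algebra Fq Fqn]
    (hcard : Fintype.card Fq = q) (hcardn : Fintype.card Fqn = q ^ n)
    (hp : ringChar Fq = p) (hn : n = d * p ^ m) (hd : ¬ p ∣ d) :
    (Nat.card {α : Fqn // IsNormalElement Fq α} : ℚ) =
      (q : ℚ) ^ n * ∏ e ∈ Nat.divisors d,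
        (1 - 1 / (q : ℚ) ^ orderOf (q : ZMod e)) ^ (Nat.totient e / orderOf (q : ZMod e)) := by
  classical
  have : CharP Fq p := ringChar.of_eq hp
  obtain ⟨k, hpp, hk⟩ := FiniteField.card Fq p
  have : Fact p.Prime := ⟨hpp⟩
  have hd0 : 0 < d := Nat.pos_of_ne_zero fun h ↦ hd (h ▸ dvd_zero p)
  have hfinrank : Module.finrank Fq Fqn = n := by
    have h := Module.card_eq_pow_finrank (K := Fq) (V := Fqn)
    rw [hcardn, hcard] at h
    exact (Nat.pow_right_injective (hcard ▸ Fintype.one_lt_card) h).symm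
  have hn0 : 0 < n := hfinrank ▸ Module.finrank_pos
  have hcop {e : ℕ} (he : e ∈ d.divisors) : p.Coprime e :=
    (hpp.coprime_iff_not_dvd.mpr hd).coprime_dvd_right (Nat.dvd_of_mem_divisors he)
  have hsq : Squarefree (∏ e ∈ d.divisors, cyclotomic e Fq) := by
    rw [prod_cyclotomic_eq_X_pow_sub_one hd0]
    exact (X_pow_sub_one_separable_iff.mpr
      fun h ↦ hd ((CharP.cast_eq_zero_iff Fq p d).mp h)).squarefree
  have hcyc : (d.divisors : Set ℕ).Pairwise (Function.onFun IsCoprime (cyclotomic · Fq)) := by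
    intro a ha b hb hab
    refine (IsRelPrime.of_squarefree_mul (hsq.squarefree_of_dvd ?_)).isCoprime
    rw [← Finset.prod_pair hab (f := (cyclotomic · Fq))]
    exact Finset.prod_dvd_prod_of_subset _ _ _ (by
      simpa [Finset.insert_subset_iff] using And.intro (by simpa using ha) (by simpa using hb))
  let N (e : ℕ) : Finset Fq[X] := (normalizedFactors (cyclotomic e Fq)).toFinset
  have hN {e P} (hP : P ∈ N e) : P ∈ normalizedFactors (cyclotomic e Fq) :=
    Multiset.mem_toFinset.mp hP
  have hdisj : (d.divisors : Set ℕ).PairwiseDisjoint N := fun a ha b hb hab ↦ by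
    refine Finset.disjoint_left.mpr fun P hPa hPb ↦ ?_
    exact (irreducible_of_normalized_factor P (hN hPa)).not_isUnit <|
      (hcyc ha hb hab).isUnit_of_dvd' (dvd_of_mem_normalizedFactors (hN hPa))
        (dvd_of_mem_normalizedFactors (hN hPb))
  have hirr {P} (hP : P ∈ d.divisors.biUnion N) : ∃ e, P ∈ normalizedFactors (cyclotomic e Fq) := by
    obtain ⟨e, -, he⟩ := Finset.mem_biUnion.mp hP
    exact ⟨e, hN he⟩
  have hmonic : (X ^ n - 1 : Fq[X]).Monic := leadingCoeff_X_pow_sub_one hn0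
  have hdeg : (X ^ n - 1 : Fq[X]).natDegree = n := natDegree_X_pow_sub_C (R := Fq) (r := 1)
  rw [natCard_isNormalElement, hfinrank, AdjoinRoot.natCard_isUnit hmonic.ne_zero
    (d.divisors.biUnion N), Finset.prod_biUnion hdisj,
    hdeg, Nat.card_eq_fintype_card, hcard]
  · congr 1
    refine Finset.prod_congr rfl fun e he ↦ ?_
    have hord : orderOf (ZMod.unitOfCoprime _ ((hcop he).pow_left k)) = orderOf (q : ZMod e) := by
      rw [← orderOf_units, ZMod.coe_unitOfCoprime, ← hk, hcard]
    rw [← hord, ← normalizedFactors_cyclotomic_card hk (hcop he)]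
    refine Finset.prod_eq_pow_card fun P hP ↦ ?_
    rw [natDegree_of_mem_normalizedFactors_cyclotomic hk (hcop he) (hN hP)]
  · intro P hP
    obtain ⟨e, he⟩ := hirr hP
    exact irreducible_of_normalized_factor P he
  · intro P hP Q hQ hPQ
    obtain ⟨a, ha⟩ := hirr hP
    obtain ⟨b, hb⟩ := hirr hQ
    refine ((irreducible_of_normalized_factor P ha).coprime_iff_not_dvd).mpr fun h ↦ hPQ ?_
    have := (irreducible_of_normalized_factor P ha).associated_of_dvd
      (irreducible_of_normalized_factor Q hb) h
    rw [← normalize_normalized_factor P ha, ← normalize_normalized_factor Q hb]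
    exact normalize_eq_normalize_iff_associated.mpr this
  · intro h
    rw [show (X ^ n - 1 : Fq[X]) = (X ^ d - 1) ^ p ^ m by
      rw [sub_pow_char_pow, one_pow, ← pow_mul, hn], IsCoprime.pow_right_iff (pow_pos hpp.pos m),
      ← prod_cyclotomic_eq_X_pow_sub_one hd0, IsCoprime.prod_right_iff]
    simp_rw [isCoprime_iff_forall_mem_normalizedFactors (cyclotomic_ne_zero _ Fq),
      Finset.mem_biUnion]
    exact ⟨fun H P ⟨e, he, hP⟩ ↦ H e he P hP, fun H e he P hP ↦ H P ⟨e, he, hP⟩⟩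
end

section
/- Let q be a prime power and n ≥ 1. The number N_n(q) of normal elements of the field extension F_{q^n}/F_q equals the number of units of the ring F_q[x]/(x^n − 1). -/
section

open Polynomial FiniteField Module

/-- If a representation of a commutative algebra has the same dimension as the algebra and
admits a cyclic vector, then it has as many cyclic vectors as the algebra has units. -/
theorem card_cyclicVector_eq_card_units {K A V : Type*} [Field K] [CommRing A] [Algebra K A]
    [AddCommGroup V] [Module K V] [FiniteDimensional K A] [FiniteDimensional K V]
    (ψ : A →ₐ[K] End K V) (hrank : finrank K A = finrank K V) (v : V)
    (hv : Function.Surjective fun a ↦ ψ a v) :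
    Nat.card {w : V // Function.Surjective fun a ↦ ψ a w} = Nat.card Aˣ := by
  let e : A →ₗ[K] V := (LinearMap.applyₗ v).comp ψ.toLinearMap
  have he : Function.Bijective e :=
    ⟨(LinearMap.injective_iff_surjective_of_finrank_eq_finrank hrank).2 hv, hv⟩
  have key (a : A) : IsUnit a ↔ Function.Surjective fun b ↦ ψ b (e a) := by
    have hcomp : (fun b ↦ ψ b (e a)) = e ∘ (· * a) := by
      ext b
      simp [e]
    rw [hcomp, Function.Surjective.of_comp_iff' he]
    exact ⟨fun h ↦ (h.unit.mulRight_bijective).surjective,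
      fun h ↦ (h 1).elim fun b hb ↦ .of_mul_eq_one_right b hb⟩
  let eUnits : Aˣ ≃ {a : A // IsUnit a} :=
    .ofBijective (fun u ↦ ⟨u, u.isUnit⟩)
      ⟨fun _ _ h ↦ Units.ext (Subtype.ext_iff.1 h), fun a ↦ ⟨a.2.unit, rfl⟩⟩
  exact (Nat.card_congr (eUnits.trans ((Equiv.ofBijective e he).subtypeEquiv key))).symm

variable (K L : Type*) [Field K] [Field L] [Algebra K L] [Fintype K] [Finite L]

/-- The action of `K[X] ⧸ (X ^ [L : K] - 1)` on `L`, with `X` acting as the Frobenius. -/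
noncomputable def frobeniusAction :
    (K[X] ⧸ Ideal.span {(X ^ finrank K L - 1 : K[X])}) →ₐ[K] End K L :=
  Ideal.Quotient.liftₐ _ (aeval (frobeniusAlgHom K L).toLinearMap) fun a ha ↦ by
    obtain ⟨b, rfl⟩ := Ideal.mem_span_singleton.1 ha
    rw [← minpoly_frobeniusAlgHom, map_mul, minpoly.aeval, zero_mul]

variable {L}

theorem range_aeval_frobenius_apply (x : L) :
    Set.range (fun p : K[X] ↦ aeval (frobeniusAlgHom K L).toLinearMap p x) =
      Submodule.span K (Set.range fun g : L ≃ₐ[K] L ↦ g x) := by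
  have hpow (i : ℕ) : ((frobeniusAlgHom K L).toLinearMap ^ i) x =
      (frobeniusAlgEquivOfAlgebraic K L ^ i) x := by
    rw [End.coe_pow, AlgEquiv.coe_pow]
    rfl
  apply Set.Subset.antisymm
  · rintro _ ⟨p, rfl⟩
    simp only [aeval_eq_sum_range, LinearMap.sum_apply, LinearMap.smul_apply, hpow]
    exact Submodule.sum_mem _ fun i _ ↦ Submodule.smul_mem _ _ (Submodule.subset_span ⟨_, rfl⟩)
  · let f : K[X] →ₗ[K] L := (LinearMap.applyₗ x).comp
      (aeval (frobeniusAlgHom K L).toLinearMap).toLinearMap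
    change _ ≤ ((LinearMap.range f : Submodule K L) : Set L)
    rw [SetLike.coe_subset_coe, Submodule.span_le]
    rintro _ ⟨g, rfl⟩
    obtain ⟨i, rfl⟩ := (bijective_frobeniusAlgEquivOfAlgebraic_pow K L).2 g
    exact ⟨X ^ (i : ℕ), by simp [f, hpow]⟩

theorem isNormalElement_iff_surjective_frobeniusAction (x : L) :
    IsNormalElement K x ↔ Function.Surjective fun a ↦ frobeniusAction K L a x := by
  have hspan : IsNormalElement K x ↔
      Submodule.span K (Set.range fun g : L ≃ₐ[K] L ↦ g x) = ⊤ :=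
    ⟨And.right, fun h ↦ ⟨linearIndependent_of_top_le_span_of_card_eq_finrank h.ge
      (Fintype.card_eq_nat_card.trans (IsGalois.card_aut_eq_finrank K L)), h⟩⟩
  rw [hspan, ← SetLike.coe_set_eq, ← range_aeval_frobenius_apply, Submodule.top_coe,
    Set.range_eq_univ, ← Ideal.Quotient.mk_surjective.of_comp_iff fun a ↦ frobeniusAction K L a x]
  rfl

variable (L) in
theorem card_isNormalElement :
    Nat.card {x : L // IsNormalElement K x} =
      Nat.card (K[X] ⧸ Ideal.span {(X ^ finrank K L - 1 : K[X])})ˣ := by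
  have hrank : finrank K (K[X] ⧸ Ideal.span {(X ^ finrank K L - 1 : K[X])}) = finrank K L := by
    rw [finrank_quotient_span_eq_natDegree]
    exact natDegree_X_pow_sub_C
  have : FiniteDimensional K (K[X] ⧸ Ideal.span {(X ^ finrank K L - 1 : K[X])}) :=
    .of_finrank_pos (by rw [hrank]; exact finrank_pos)
  obtain ⟨x, hx⟩ := exists_linearIndependent_algEquiv_apply K L
  have hx' : IsNormalElement K x := ⟨hx, hx.span_eq_top_of_card_eq_finrank'
    (Fintype.card_eq_nat_card.trans (IsGalois.card_aut_eq_finrank K L))⟩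
  simp only [isNormalElement_iff_surjective_frobeniusAction] at hx' ⊢
  exact card_cyclicVector_eq_card_units (frobeniusAction K L) hrank x hx'

end

/-- For a prime power `q` and `n ≥ 1`, the number of normal elements of `𝔽_{q^n}/𝔽_q` equals
the number of units of the ring `𝔽_q[x]/(x^n - 1)`. -/
theorem card_normal_eq_card_units (q n : ℕ) (hq : ∃ p k : ℕ, p.Prime ∧ 0 < k ∧ q = p ^ k)
    (hn : 1 ≤ n) (Fq Fqn : Type*) [Field Fq] [Field Fqn] [Fintype Fq] [Fintype Fqn]
    [Algebra Fq Fqn] (hcard : Fintype.card Fq = q) (hcardn : Fintype.card Fqn = q ^ n) :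
    Nat.card {α : Fqn // IsNormalElement Fq α} =
      Nat.card (Polynomial Fq ⧸ Ideal.span {(Polynomial.X ^ n - 1 : Polynomial Fq)})ˣ := by
  have hrank : Module.finrank Fq Fqn = n := by
    have h := Module.card_eq_pow_finrank (K := Fq) (V := Fqn)
    rw [hcardn, hcard] at h
    exact (Nat.pow_right_injective (hcard ▸ Fintype.one_lt_card) h).symm
  rw [card_isNormalElement, hrank]
end

section
/- Let q be a prime power with p = char(F_q), and write n = d·p^m where p does not divide d. Then the number of units of the ring F_q[x]/(x^n − 1) equals q^n · ∏_{e ∣ d} (1 − 1/q^{o_e(q)})^{φ(e)/o_e(q)}, where the product runs over all positive divisors e of d, o_e(q) is the multiplicative order of q modulo e, and φ is Euler's totient function. -/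
open Polynomial UniqueFactorizationMonoid

/-- The units of a finite ring with a surjective local homomorphism onto a field. -/
theorem card_units_of_surjective_of_isLocalHom {R S : Type*} [CommRing R] [Finite R] [Field S]
    (f : R →+* S) (hf : Function.Surjective f) [IsLocalHom f] :
    (Nat.card Rˣ : ℚ) = Nat.card R * (1 - 1 / Nat.card S) := by
  classical
  have hker : Nat.card R = Nat.card f.toAddMonoidHom.ker * Nat.card S := by
    rw [← AddSubgroup.card_mul_index f.toAddMonoidHom.ker, AddSubgroup.index_ker,
      AddMonoidHom.range_eq_top.mpr hf, AddSubgroup.card_top]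
  have hunits : Nat.card Rˣ + Nat.card f.toAddMonoidHom.ker = Nat.card R := by
    have h : Nat.card Rˣ = Nat.card {x : R // ¬ x ∈ f.toAddMonoidHom.ker} := by
      rw [Nat.card_congr (Equiv.ofInjective _ (Units.val_injective (α := R)))]
      refine Nat.card_congr (Equiv.subtypeEquivRight fun x ↦ ?_)
      change IsUnit x ↔ _
      rw [← isUnit_map_iff f x, isUnit_iff_ne_zero]
      rfl
    rw [h, add_comm, ← Nat.card_congr (Equiv.sumCompl (· ∈ f.toAddMonoidHom.ker)), Nat.card_sum]
  have : Finite S := Finite.of_surjective f hf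
  have hS : (Nat.card S : ℚ) ≠ 0 := by exact_mod_cast Nat.card_pos.ne'
  have h : (Nat.card Rˣ : ℚ) + Nat.card f.toAddMonoidHom.ker = Nat.card R := by
    exact_mod_cast hunits
  rw [eq_sub_of_add_eq h, hker]
  push_cast
  field_simp

/-- The Chinese remainder theorem for unit groups: the number of units modulo a product of
coprime elements is the product of the numbers of units. -/
theorem card_units_quotient_span_mul {R : Type*} [CommRing R] {a b : R} (h : IsCoprime a b) :
    Nat.card (R ⧸ Ideal.span {a * b})ˣ =
      Nat.card (R ⧸ Ideal.span {a})ˣ * Nat.card (R ⧸ Ideal.span {b})ˣ := by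
  rw [← Nat.card_prod, ← Ideal.span_singleton_mul_span_singleton]
  exact Nat.card_congr <| ((Units.mapEquiv (Ideal.quotientMulEquivQuotientProd _ _
    ((Ideal.isCoprime_span_singleton_iff a b).mpr h)).toMulEquiv).trans
      MulEquiv.prodUnits).toEquiv

namespace Polynomial

variable {K : Type*} [Field K]

theorem natCard_quotient_span_singleton [Finite K] {f : K[X]} (hf : f ≠ 0) :
    Nat.card (K[X] ⧸ Ideal.span {f}) = Nat.card K ^ f.natDegree := by
  have : Module.Finite K (K[X] ⧸ Ideal.span {f}) := (AdjoinRoot.powerBasis hf).finite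
  rw [Module.natCard_eq_pow_finrank (K := K), finrank_quotient_span_eq_natDegree]

/-- The analogue for `K[X]`, with `K` a finite field, of Euler's product formula for the
totient function. -/
theorem card_units_quotient_span_singleton [Finite K] [DecidableEq K] {f : K[X]} (hf : f ≠ 0) :
    (Nat.card (K[X] ⧸ Ideal.span {f})ˣ : ℚ) = (Nat.card K : ℚ) ^ f.natDegree *
      ∏ P ∈ primeFactors f, (1 - 1 / (Nat.card K : ℚ) ^ P.natDegree) := by
  induction f using induction_on_coprime with
  | h0 => exact absurd rfl hf
  | @h1 x hx =>
    have : Subsingleton (K[X] ⧸ Ideal.span {x}) :=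
      Ideal.Quotient.subsingleton_iff.mpr (Ideal.span_singleton_eq_top.mpr hx)
    simp [primeFactors_of_isUnit hx, natDegree_eq_zero_of_isUnit hx]
  | @hpr P i hP =>
    rcases eq_or_ne i 0 with rfl | hi
    · have : Subsingleton (K[X] ⧸ Ideal.span {(P ^ 0 : K[X])}) :=
        Ideal.Quotient.subsingleton_iff.mpr (Ideal.span_singleton_eq_top.mpr (by simp))
      simp
    have hmax : (Ideal.span {P}).IsMaximal :=
      PrincipalIdealRing.isMaximal_of_irreducible hP.irreducible
    let := Ideal.Quotient.field (Ideal.span {P})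
    have hcard := natCard_quotient_span_singleton hf
    have : Finite (K[X] ⧸ Ideal.span {P ^ i}) :=
      Nat.finite_of_card_ne_zero (by rw [hcard]; exact (pow_pos Nat.card_pos _).ne')
    have hle : Ideal.span {P ^ i} ≤ Ideal.span {P} :=
      Ideal.span_singleton_le_span_singleton.mpr (dvd_pow_self P hi)
    have : IsLocalHom (Ideal.Quotient.factor hle) := by
      refine ⟨fun a ha ↦ ?_⟩
      obtain ⟨a, rfl⟩ := Ideal.Quotient.mk_surjective a
      rw [Ideal.Quotient.factor_mk] at ha
      have := (Ideal.Quotient.isUnit_mk_pow_iff_isUnit_mk (Ideal.span {P}) hi).mpr ha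
      rwa [Ideal.span_singleton_pow] at this
    rw [card_units_of_surjective_of_isLocalHom _ (Ideal.Quotient.factor_surjective hle), hcard,
      natCard_quotient_span_singleton hP.ne_zero, primeFactors_pow P hi,
      ← toFinset_normalizedFactors,
      normalizedFactors_irreducible hP.irreducible, Multiset.toFinset_singleton,
      Finset.prod_singleton, natDegree_eq_of_degree_eq degree_normalize]
    push_cast
    rfl
  | @hcp x y hxy ihx ihy =>
    have hx := left_ne_zero_of_mul hf
    have hy := right_ne_zero_of_mul hf
    rw [card_units_quotient_span_mul hxy.isCoprime, primeFactors_mul_eq_disjUnion hxy,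
      Finset.prod_disjUnion, natDegree_mul hx hy]
    push_cast
    rw [ihx hx, ihy hy]
    ring

/-- A product over the prime factors of `X ^ d - 1` splits as a product over the prime factors
of the cyclotomic polynomials of index dividing `d`. -/
theorem prod_primeFactors_X_pow_sub_one [DecidableEq K] {M : Type*} [CommMonoid M] {d : ℕ} (hd : (d : K) ≠ 0)
    (g : K[X] → M) :
    ∏ P ∈ primeFactors (X ^ d - 1 : K[X]), g P =
      ∏ e ∈ d.divisors, ∏ P ∈ primeFactors (cyclotomic e K), g P := by
  have hprod := prod_cyclotomic_eq_X_pow_sub_one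
    (Nat.pos_of_ne_zero fun h : d = 0 ↦ hd (by simp [h])) K
  have hsq := (X_pow_sub_one_separable_iff.mpr hd).squarefree
  rw [← hprod] at hsq ⊢
  generalize d.divisors = s at hsq ⊢
  induction s using Finset.induction_on with
  | empty => simp
  | insert e s he ih =>
    rw [Finset.prod_insert he, squarefree_mul_iff] at hsq
    rw [Finset.prod_insert he, Finset.prod_insert he, primeFactors_mul_eq_disjUnion hsq.1,
      Finset.prod_disjUnion, ih hsq.2.2]

theorem prod_primeFactors_cyclotomic [Fintype K] [DecidableEq K] {M : Type*} [CommMonoid M]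
    {e : ℕ}
    (he : (ringChar K).Coprime e) (g : ℕ → M) :
    ∏ P ∈ primeFactors (cyclotomic e K), g P.natDegree =
      g (orderOf (Fintype.card K : ZMod e)) ^
        (e.totient / orderOf (Fintype.card K : ZMod e)) := by
  obtain ⟨k, hp, hK⟩ := FiniteField.card K (ringChar K)
  have : Fact (ringChar K).Prime := ⟨hp⟩
  have horder : orderOf (ZMod.unitOfCoprime _ (he.pow_left (k : ℕ))) =
      orderOf (Fintype.card K : ZMod e) := by
    rw [← orderOf_units, ZMod.coe_unitOfCoprime, hK]
  rw [← horder, ← normalizedFactors_cyclotomic_card hK he, toFinset_normalizedFactors]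
  refine Finset.prod_eq_pow_card fun P hP ↦ ?_
  rw [natDegree_of_mem_normalizedFactors_cyclotomic hK he (mem_primeFactors.mp hP)]

end Polynomial

/-- If `p = char 𝔽_q` and `n = d * p ^ m` with `p ∤ d`, then the number of units of
`𝔽_q[x]/(x^n - 1)` is `q ^ n * ∏_{e ∣ d} (1 - 1/q^{o_e(q)})^{φ(e)/o_e(q)}`, where `o_e(q)` is
the multiplicative order of `q` modulo `e` and `φ` is Euler's totient function. -/
theorem card_units_quotient_X_pow_sub_one (q p n d m : ℕ)
    (hq : ∃ p' k : ℕ, p'.Prime ∧ 0 < k ∧ q = p' ^ k)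
    (Fq : Type*) [Field Fq] [Fintype Fq] (hcard : Fintype.card Fq = q)
    (hp : ringChar Fq = p) (hn : n = d * p ^ m) (hd : ¬ p ∣ d) :
    (Nat.card (Polynomial Fq ⧸ Ideal.span {(Polynomial.X ^ n - 1 : Polynomial Fq)})ˣ : ℚ) =
      (q : ℚ) ^ n * ∏ e ∈ Nat.divisors d,
        (1 - 1 / (q : ℚ) ^ orderOf (q : ZMod e)) ^ (Nat.totient e / orderOf (q : ZMod e)) := by
  classical
  subst hp hcard
  have hprime : (ringChar Fq).Prime := CharP.char_is_prime Fq _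
  have : Fact (ringChar Fq).Prime := ⟨hprime⟩
  have hd0 : (d : Fq) ≠ 0 := fun h ↦ hd ((ringChar.spec Fq d).mp h)
  have hn0 : 0 < n := by
    rw [hn]
    exact Nat.mul_pos (Nat.pos_of_ne_zero fun h ↦ hd (h ▸ dvd_zero _)) (pow_pos hprime.pos m)
  have hpow : (X ^ n - 1 : Fq[X]) = (X ^ d - 1) ^ ringChar Fq ^ m := by
    rw [sub_pow_char_pow, one_pow, ← pow_mul, hn]
  rw [card_units_quotient_span_singleton (by simpa using X_pow_sub_C_ne_zero hn0 (1 : Fq)), Nat.card_eq_fintype_card]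
  congr 1
  · rw [← C_1, natDegree_X_pow_sub_C]
  rw [hpow, primeFactors_pow _ (pow_pos hprime.pos m).ne', prod_primeFactors_X_pow_sub_one hd0]
  refine Finset.prod_congr rfl fun e he ↦ ?_
  have hcop : (ringChar Fq).Coprime e :=
    ((hprime.coprime_iff_not_dvd).mpr hd).coprime_dvd_right (Nat.dvd_of_mem_divisors he)
  exact prod_primeFactors_cyclotomic hcop fun k ↦ 1 - 1 / (Fintype.card Fq : ℚ) ^ k
end
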